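/- Let N be an even positive integer, M an odd positive integer with 2M ≤ N, let N_a be a positive integer with N ≤ N_a, and let 0 < U₀ ≤ U₁. Consider the set S ⊆ ℝ^N × ℝ^M × ℝ of all triples (k, Λ, U) such that U ∈ [U₀, U₁], −π ≤ k_1 < ⋯ < k_N ≤ π, Λ_1 < ⋯ < Λ_M, and (k, Λ) satisfies the Lieb–Wu equations with coupling U. Then S contains a connected subset C that intersects both the slice {U = U₀} and the slice {U = U₁}. -/

import Mathlib

open Real

/-- The phase function `θ_U(x) = -2 arctan(2x/U)` of the Lieb–Wu equations. -/
noncomputable def theta (U x : ℝ) : ℝ := -2 * Real.arctan (2 * x / U)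

open MeasureTheory Metric Set Filter Topology
open scoped NNReal

/-- Lagrange interpolation, applied to the polynomial `t ↦ det (1 + t A)`. -/
theorem det_id_add_eq_sum_lagrange {K V : Type*} [Field K] [DecidableEq K] [AddCommGroup V]
    [Module K V] [FiniteDimensional K V] (s : Finset K)
    (hs : Module.finrank K V < s.card) (A : V →ₗ[K] V) :
    LinearMap.det (LinearMap.id + A : V →ₗ[K] V) =
      ∑ t ∈ s, (Lagrange.basis s id t).eval 1 *
        LinearMap.det (LinearMap.id + t • A : V →ₗ[K] V) := by
  let b := Module.finBasis K V
  let B := LinearMap.toMatrix b b A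
  let P : Polynomial K := Matrix.det ((Polynomial.X : Polynomial K) • B.map Polynomial.C +
    (1 : Matrix _ _ K).map Polynomial.C)
  have hP (t : K) : P.eval t = LinearMap.det (LinearMap.id + t • A : V →ₗ[K] V) := by
    rw [← LinearMap.det_toMatrix b]
    simp only [P, B, map_add, map_smul, LinearMap.toMatrix_id]
    rw [← Polynomial.coe_evalRingHom, RingHom.map_det, add_comm]
    congr 1
    ext i j
    simp [mul_comm t, Matrix.one_apply, apply_ite (Polynomial.eval t)]
  have hdeg : P.degree < s.card := by
    refine lt_of_le_of_lt Polynomial.degree_le_natDegree ?_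
    have := Polynomial.natDegree_det_X_add_C_le B 1
    simp only [Fintype.card_fin] at this
    exact_mod_cast this.trans_lt hs
  have key := congrArg (Polynomial.eval 1) (Lagrange.eq_interpolate (v := id)
    Function.injective_id.injOn hdeg)
  rw [hP, one_smul, Lagrange.interpolate_apply, Polynomial.eval_finsetSum] at key
  rw [key]
  refine Finset.sum_congr rfl fun t _ => ?_
  rw [Polynomial.eval_mul, Polynomial.eval_C, id, hP, mul_comm]

section
variable {E : Type*} [NormedAddCommGroup E] [NormedSpace ℝ E] [FiniteDimensional ℝ E]

omit [FiniteDimensional ℝ E] in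
theorem eventually_forall_det_id_add_smul_pos (K : ℝ) :
    ∀ᶠ t : ℝ in 𝓝 0, ∀ A : E →L[ℝ] E, ‖A‖ ≤ K →
      0 < (ContinuousLinearMap.id ℝ E + t • A).det := by
  have h1 : ∀ᶠ A : E →L[ℝ] E in 𝓝 0, 0 < (ContinuousLinearMap.id ℝ E + A).det := by
    have hc : ContinuousAt (fun A : E →L[ℝ] E => (ContinuousLinearMap.id ℝ E + A).det) 0 :=
      (ContinuousLinearMap.continuous_det.comp (continuous_const.add continuous_id)).continuousAt
    refine hc.eventually_const_lt ?_
    simp [ContinuousLinearMap.det]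
  obtain ⟨ε, hε, h⟩ := Metric.eventually_nhds_iff_ball.1 h1
  have h2 : ∀ᶠ t : ℝ in 𝓝 0, |t| * K < ε := by
    have hc : ContinuousAt (fun t : ℝ => |t| * K) 0 := by fun_prop
    exact hc.eventually_lt_const (by simpa using hε)
  filter_upwards [h2] with t ht A hA
  refine h _ ?_
  rw [mem_ball_zero_iff, norm_smul, Real.norm_eq_abs]
  exact (mul_le_mul_of_nonneg_left hA (abs_nonneg t)).trans_lt ht

/-- A small Lipschitz perturbation of the identity that is supported in the set `U` maps `U`
bijectively onto itself. -/
theorem injOn_image_eq_of_lipschitzWith {h : E → E} {K : ℝ≥0} (hK : LipschitzWith K h) {U : Set E}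
    (hU : ∀ x ∉ U, h x = 0) {t : ℝ} (ht : |t| * K < 1) :
    InjOn (fun x => x + t • h x) U ∧ (fun x => x + t • h x) '' U = U := by
  have hA : ApproximatesLinearOn (fun x => x + t • h x)
      ((ContinuousLinearEquiv.refl ℝ E : E ≃L[ℝ] E) : E →L[ℝ] E) univ (‖t‖₊ * K) := by
    intro x _ y _
    have : x + t • h x - (y + t • h y) - (x - y) = t • (h x - h y) := by
      rw [smul_sub]; abel
    simp only [ContinuousLinearEquiv.coe_refl, ContinuousLinearMap.id_apply, this, norm_smul]
    rw [NNReal.coe_mul, coe_nnnorm, mul_assoc]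
    exact mul_le_mul_of_nonneg_left (hK.norm_sub_le x y) (norm_nonneg t)
  have hc : Subsingleton E ∨ ‖t‖₊ * K <
      ‖((ContinuousLinearEquiv.refl ℝ E).symm : E →L[ℝ] E)‖₊⁻¹ := by
    rcases subsingleton_or_nontrivial E with h | h
    · exact Or.inl h
    · right
      rw [← NNReal.coe_lt_coe]
      simpa using ht
  let e := hA.toHomeomorph _ hc
  have he : ∀ x, e x = x + t • h x := fun x => rfl
  have heq : (fun x => x + t • h x) = e := rfl
  rw [heq]
  refine ⟨e.injective.injOn, ?_⟩
  have hout : ∀ x ∉ U, e x = x := fun x hx => by rw [he, hU x hx]; simp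
  ext y
  constructor
  · rintro ⟨x, hx, rfl⟩
    by_contra hy
    have := e.injective (hout _ hy)
    rw [this] at hy
    exact hy hx
  · intro hy
    obtain ⟨x, rfl⟩ := e.surjective y
    refine ⟨x, ?_, rfl⟩
    by_contra hx
    rw [hout x hx] at hy
    exact hx hy

variable [MeasurableSpace E] [BorelSpace E] (μ : Measure E) [μ.IsAddHaarMeasure]

theorem integrableOn_det_id_add_fderiv {h : E → E} {K : ℝ≥0} (hK : LipschitzWith K h) {U : Set E}
    (hb : Bornology.IsBounded U) (t : ℝ) :
    IntegrableOn (fun x => (ContinuousLinearMap.id ℝ E + t • fderiv ℝ h x).det) U μ := by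
  have hfin : μ U ≠ ⊤ := hb.measure_lt_top.ne
  have hcont : Continuous fun A : E →L[ℝ] E => (ContinuousLinearMap.id ℝ E + t • A).det :=
    ContinuousLinearMap.continuous_det.comp (by fun_prop)
  obtain ⟨C, hC⟩ := (isCompact_closedBall (0 : E →L[ℝ] E) K).exists_bound_of_continuousOn
    hcont.continuousOn
  refine Measure.integrableOn_of_bounded (M := C) hfin ?_ ?_
  · exact (hcont.measurable.comp (measurable_fderiv ℝ h)).aestronglyMeasurable
  · refine Eventually.of_forall fun x => hC _ ?_
    simpa using norm_fderiv_le_of_lipschitz ℝ hK (x₀ := x)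

theorem integral_det_id_add_fderiv {h : E → E} {K : ℝ≥0} (hK : LipschitzWith K h) {U : Set E}
    (hUo : IsOpen U) (hb : Bornology.IsBounded U) (hU : ∀ x ∉ U, h x = 0)
    (hd : ∀ x ∈ U, DifferentiableAt ℝ h x) :
    ∫ x in U, (ContinuousLinearMap.id ℝ E + fderiv ℝ h x).det ∂μ = μ.real U := by
  have hsmall : ∀ᶠ t : ℝ in 𝓝 0,
      ∫ x in U, (ContinuousLinearMap.id ℝ E + t • fderiv ℝ h x).det ∂μ = μ.real U := by
    have h2 : ∀ᶠ t : ℝ in 𝓝 0, |t| * K < 1 := by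
      have hc : ContinuousAt (fun t : ℝ => |t| * K) 0 := by fun_prop
      exact hc.eventually_lt_const (by simp)
    filter_upwards [eventually_forall_det_id_add_smul_pos (E := E) K, h2] with t hpos ht
    obtain ⟨hinj, himg⟩ := injOn_image_eq_of_lipschitzWith hK hU ht
    have hlin := lintegral_abs_det_fderiv_eq_addHaar_image μ hUo.measurableSet
      (f := fun x => x + t • h x)
      (f' := fun x => ContinuousLinearMap.id ℝ E + t • fderiv ℝ h x)
      (fun x hx => ((hasFDerivAt_id x).add
        ((hd x hx).hasFDerivAt.const_smul t)).hasFDerivWithinAt) hinj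
    rw [himg] at hlin
    have hp : ∀ x, 0 < (ContinuousLinearMap.id ℝ E + t • fderiv ℝ h x).det := fun x =>
      hpos _ (norm_fderiv_le_of_lipschitz ℝ hK)
    simp only [abs_of_pos (hp _)] at hlin
    rw [measureReal_def, ← hlin, integral_eq_lintegral_of_nonneg_ae
      (Eventually.of_forall fun x => (hp x).le)
      (integrableOn_det_id_add_fderiv μ hK hb t).aestronglyMeasurable]
  obtain ⟨ε, hε, hball⟩ := Metric.eventually_nhds_iff_ball.1 hsmall
  obtain ⟨s, hs, hcard⟩ := (infinite_of_mem_nhds (0 : ℝ)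
    (ball_mem_nhds 0 hε)).exists_subset_card_eq (Module.finrank ℝ E + 1)
  have hlag : ∀ A : E →L[ℝ] E, (ContinuousLinearMap.id ℝ E + A).det =
      ∑ t ∈ s, (Lagrange.basis s id t).eval 1 * (ContinuousLinearMap.id ℝ E + t • A).det :=
    fun A => det_id_add_eq_sum_lagrange s (by omega) (A : E →ₗ[ℝ] E)
  rw [integral_congr_ae (Eventually.of_forall fun x => hlag (fderiv ℝ h x)), integral_finsetSum]
  · simp only [integral_const_mul]
    rw [Finset.sum_congr rfl fun t ht => by rw [hball t (hs ht)], ← Finset.sum_mul,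
      ← Polynomial.eval_finsetSum, Lagrange.sum_basis Function.injective_id.injOn
      (Finset.card_pos.1 (by omega)), Polynomial.eval_one, one_mul]
  · exact fun t _ => (integrableOn_det_id_add_fderiv μ hK hb t).const_mul _
end

theorem LipschitzOnWith.indicator_ball {E F : Type*} [NormedAddCommGroup E] [NormedSpace ℝ E]
    [NormedAddCommGroup F] {h : E → F} {K : ℝ≥0} (hK : LipschitzOnWith K h (closedBall 0 1))
    (h0 : ∀ x ∈ sphere (0 : E) 1, h x = 0) : LipschitzWith K ((ball 0 1).indicator h) := by
  have hin : ∀ x ∈ closedBall (0 : E) 1, (ball 0 1).indicator h x = h x := by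
    intro x hx
    by_cases hx' : x ∈ ball (0 : E) 1
    · exact indicator_of_mem hx' h
    · rw [indicator_of_notMem hx', h0 x]
      rw [← closedBall_sdiff_ball]
      exact ⟨hx, hx'⟩
  have hmix : ∀ x ∈ closedBall (0 : E) 1, ∀ y ∉ closedBall (0 : E) 1,
      dist ((ball 0 1).indicator h x) ((ball 0 1).indicator h y) ≤ K * dist x y := by
    intro x hx y hy
    have hy' : y ∉ ball (0 : E) 1 := fun h' => hy (ball_subset_closedBall h')
    obtain ⟨z, hz, hz1⟩ := (convex_segment x y).isPreconnected.intermediate_value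
      (left_mem_segment ℝ x y) (right_mem_segment ℝ x y) continuous_norm.continuousOn
      (show (1 : ℝ) ∈ Icc ‖x‖ ‖y‖ from
        ⟨mem_closedBall_zero_iff.1 hx, by rw [mem_closedBall_zero_iff] at hy; linarith⟩)
    have hzs : z ∈ sphere (0 : E) 1 := mem_sphere_zero_iff_norm.2 hz1
    rw [hin x hx, indicator_of_notMem hy', ← h0 z hzs]
    refine (hK.dist_le_mul x hx z (sphere_subset_closedBall hzs)).trans ?_
    have := dist_add_dist_of_mem_segment hz
    gcongr
    linarith [dist_nonneg (x := z) (y := y)]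
  refine LipschitzWith.of_dist_le_mul fun x y => ?_
  by_cases hx : x ∈ closedBall (0 : E) 1 <;> by_cases hy : y ∈ closedBall (0 : E) 1
  · rw [hin x hx, hin y hy]
    exact hK.dist_le_mul x hx y hy
  · exact hmix x hx y hy
  · rw [dist_comm, dist_comm x]
    exact hmix y hy x hx
  · rw [indicator_of_notMem fun h' => hx (ball_subset_closedBall h'),
      indicator_of_notMem fun h' => hy (ball_subset_closedBall h'), dist_self]
    positivity

section
variable {E : Type*} [NormedAddCommGroup E] [InnerProductSpace ℝ E]

theorem det_fderiv_eq_zero_of_norm_eq_one [FiniteDimensional ℝ E] {r : E → E} {r' : E →L[ℝ] E}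
    {x : E} (hr : HasFDerivAt r r' x) (h1 : ∀ᶠ y in 𝓝 x, ‖r y‖ = 1) : r'.det = 0 := by
  by_contra hdet
  have hz : HasFDerivAt (fun y => ‖r y‖ ^ 2) (0 : E →L[ℝ] ℝ) x :=
    (hasFDerivAt_const (1 : ℝ) x).congr_of_eventuallyEq (h1.mono fun y hy => by simp [hy])
  have hz' := hr.norm_sq
  have horth : ∀ v, inner ℝ (r x) (r' v) = 0 := by
    intro v
    have := DFunLike.congr_fun (hz'.unique hz) v
    simpa using this
  have hsurj : Function.Surjective r' :=
    (LinearMap.equivOfDetNeZero (r' : E →ₗ[ℝ] E) hdet).surjective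
  obtain ⟨v, hv⟩ := hsurj (r x)
  have := horth v
  rw [hv, inner_self_eq_zero] at this
  simpa [this] using h1.self_of_nhds

/-- The point at which the ray from `y` through `x` leaves the unit ball is `x + c • (x - y)` where
`c = exitParam x (x - y)`. -/
noncomputable def exitParam (x w : E) : ℝ :=
  (-inner ℝ x w + √(inner ℝ x w ^ 2 + ‖w‖ ^ 2 * (1 - ‖x‖ ^ 2))) / ‖w‖ ^ 2

theorem norm_add_exitParam_smul {x w : E} (hw : w ≠ 0)
    (hD : 0 ≤ inner ℝ x w ^ 2 + ‖w‖ ^ 2 * (1 - ‖x‖ ^ 2)) : ‖x + exitParam x w • w‖ = 1 := by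
  have hw' : ‖w‖ ^ 2 ≠ 0 := by positivity
  have hsq := Real.sq_sqrt hD
  rw [← sq_eq_sq₀ (norm_nonneg _) zero_le_one, norm_add_sq_real, inner_smul_right, norm_smul,
    mul_pow, Real.norm_eq_abs, sq_abs]
  unfold exitParam
  set s := √(inner ℝ x w ^ 2 + ‖w‖ ^ 2 * (1 - ‖x‖ ^ 2))
  field_simp
  linear_combination hsq

theorem inner_sub_pos_of_norm_eq_one {x y : E} (hx : ‖x‖ = 1) (hy : ‖y‖ ≤ 1) (hxy : y ≠ x) :
    0 < inner ℝ x (x - y) := by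
  have h1 := norm_sub_sq_real x y
  have h2 : 0 < ‖x - y‖ := norm_pos_iff.2 (sub_ne_zero.2 hxy.symm)
  rw [inner_sub_right, real_inner_self_eq_norm_sq, hx]
  rw [hx] at h1
  nlinarith [norm_nonneg y]

theorem discr_pos {x y : E} (hx : ‖x‖ ≤ 1) (hy : ‖y‖ ≤ 1) (hxy : y ≠ x) :
    0 < inner ℝ x (x - y) ^ 2 + ‖x - y‖ ^ 2 * (1 - ‖x‖ ^ 2) := by
  have h2 : 0 < ‖x - y‖ := norm_pos_iff.2 (sub_ne_zero.2 hxy.symm)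
  rcases hx.eq_or_lt with hx | hx
  · have := inner_sub_pos_of_norm_eq_one hx hy hxy
    rw [hx]
    nlinarith
  · have : 0 < 1 - ‖x‖ ^ 2 := by nlinarith [norm_nonneg x]
    positivity

theorem exitParam_eq_zero {x y : E} (hx : ‖x‖ = 1) (hy : ‖y‖ ≤ 1) (hxy : y ≠ x) :
    exitParam x (x - y) = 0 := by
  have := inner_sub_pos_of_norm_eq_one hx hy hxy
  simp [exitParam, hx, Real.sqrt_sq this.le]

variable [FiniteDimensional ℝ E]

theorem exists_eq_of_contDiff {f : E → E} (hf : ContDiff ℝ 1 f) (hf1 : ∀ x, ‖f x‖ ≤ 1) :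
    ∃ x, f x = x := by
  by_contra! hne
  borelize E
  have hw : ∀ x, x - f x ≠ 0 := fun x => sub_ne_zero.2 (hne x).symm
  let h : E → E := fun x => exitParam x (x - f x) • (x - f x)
  have hh : ∀ x ∈ closedBall (0 : E) 1, ContDiffAt ℝ 1 h x := by
    intro x hx
    have hD := discr_pos (mem_closedBall_zero_iff.1 hx) (hf1 x) (hne x)
    have hfx : ContDiffAt ℝ 1 (fun x => x - f x) x := contDiffAt_id.sub hf.contDiffAt
    have hin : ContDiffAt ℝ 1 (fun x => (inner ℝ x (x - f x) : ℝ)) x := contDiffAt_id.inner ℝ hfx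
    have hn : ContDiffAt ℝ 1 (fun x => ‖x - f x‖ ^ 2) x := hfx.norm_sq ℝ
    have hn' : ContDiffAt ℝ 1 (fun x : E => ‖x‖ ^ 2) x := contDiffAt_id.norm_sq ℝ
    refine ContDiffAt.smul (ContDiffAt.div (hin.neg.add (ContDiffAt.sqrt
      ((hin.pow 2).add (hn.mul (contDiffAt_const.sub hn'))) hD.ne')) hn ?_) hfx
    have := norm_pos_iff.2 (hw x)
    positivity
  obtain ⟨K, hK⟩ := ContDiffOn.exists_lipschitzOnWith
    (fun x hx => (hh x hx).contDiffWithinAt : ContDiffOn ℝ 1 h (closedBall 0 1)) one_ne_zero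
    (convex_closedBall 0 1) (isCompact_closedBall 0 1)
  have h0 : ∀ x ∈ sphere (0 : E) 1, h x = 0 := by
    intro x hx
    simp [h, exitParam_eq_zero (mem_sphere_zero_iff_norm.1 hx) (hf1 x) (hne x)]
  have hext : ∀ x ∈ ball (0 : E) 1, (ball (0 : E) 1).indicator h =ᶠ[𝓝 x] h := fun x hx =>
    (isOpen_ball.eventually_mem hx).mono fun y hy => indicator_of_mem hy h
  have hd : ∀ x ∈ ball (0 : E) 1, DifferentiableAt ℝ ((ball (0 : E) 1).indicator h) x :=
    fun x hx =>
      ((hh x (ball_subset_closedBall hx)).differentiableAt one_ne_zero).congr_of_eventuallyEq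
      (hext x hx)
  have hint := integral_det_id_add_fderiv volume (hK.indicator_ball h0) isOpen_ball isBounded_ball
    (fun x hx => indicator_of_notMem hx h) hd
  rw [setIntegral_congr_fun (g := fun _ => (0 : ℝ)) measurableSet_ball] at hint
  · have : 0 < (volume : Measure E).real (ball 0 1) :=
      ENNReal.toReal_pos (measure_ball_pos _ _ one_pos).ne' measure_ball_lt_top.ne
    simp at hint
    linarith
  · intro x hx
    refine det_fderiv_eq_zero_of_norm_eq_one ((hasFDerivAt_id x).add (hd x hx).hasFDerivAt) ?_
    filter_upwards [hext x hx, isOpen_ball.eventually_mem hx] with y hy hyb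
    simp only [Pi.add_apply, id, hy]
    exact norm_add_exitParam_smul (hw y)
      (discr_pos (mem_closedBall_zero_iff.1 (ball_subset_closedBall hyb)) (hf1 y) (hne y)).le

theorem exists_eq_of_norm_le_one {f : E → E} (hf : Continuous f) (hf1 : ∀ x, ‖f x‖ ≤ 1) :
    ∃ x, f x = x := by
  by_contra! hne
  obtain ⟨g, hg⟩ := exists_contMDiffMap_forall_mem_convex_of_local_const (n := 1)
    (modelWithCornersSelf ℝ E)
    (t := fun x => closedBall (0 : E) 1 ∩ ball (f x) (dist (f x) x))
    (fun x => (convex_closedBall _ _).inter (convex_ball _ _)) (fun x => by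
      refine ⟨f x, ?_⟩
      have hopen : ∀ᶠ y in 𝓝 x, dist (f x) (f y) < dist (f y) y :=
        ContinuousAt.eventually_lt (by fun_prop) (by fun_prop)
          (by simpa using dist_pos.2 (hne x))
      filter_upwards [hopen] with y hy
      exact ⟨mem_closedBall_zero_iff.2 (hf1 x), hy⟩)
  obtain ⟨x, hx⟩ := exists_eq_of_contDiff (f := g) g.contMDiff.contDiff
    fun x => mem_closedBall_zero_iff.1 (hg x).1
  have := (hg x).2
  rw [hx, mem_ball, dist_comm] at this
  exact lt_irrefl _ this
end

/-- **Brouwer's fixed point theorem**, for maps with bounded range. -/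
theorem exists_eq_of_isBounded_range {E : Type*} [NormedAddCommGroup E] [NormedSpace ℝ E]
    [FiniteDimensional ℝ E] {f : E → E} (hf : Continuous f)
    (hb : Bornology.IsBounded (range f)) : ∃ x, f x = x := by
  let e : E ≃L[ℝ] EuclideanSpace ℝ (Fin (Module.finrank ℝ E)) := toEuclidean
  obtain ⟨C, hC0, hC⟩ := (e.lipschitz.isBounded_image hb).exists_pos_norm_le
  obtain ⟨x, hx⟩ := exists_eq_of_norm_le_one
    (f := fun x => C⁻¹ • e (f (e.symm (C • x)))) (by fun_prop) (fun x => by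
      rw [norm_smul, norm_inv, Real.norm_of_nonneg hC0.le, inv_mul_le_one₀ hC0]
      exact hC _ (mem_image_of_mem _ (mem_range_self _)))
  refine ⟨e.symm (C • x), e.injective ?_⟩
  rw [e.apply_symm_apply]
  nth_rewrite 2 [← hx]
  rw [smul_inv_smul₀ (ne_of_gt hC0)]

/-- Two closed subsets of a compact Hausdorff space that no connected component meets both of are
separated by a clopen set. -/
theorem exists_isClopen_of_disjoint_connectedComponent {X : Type*} [TopologicalSpace X]
    [CompactSpace X] [T2Space X] {A B : Set X} (hA : IsClosed A) (hB : IsClosed B)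
    (h : ∀ a ∈ A, Disjoint (connectedComponent a) B) :
    ∃ Z : Set X, IsClopen Z ∧ A ⊆ Z ∧ Disjoint Z B := by
  let q : X → ConnectedComponents X := (↑)
  have hq : Continuous q := ConnectedComponents.continuous_coe
  obtain ⟨Z, hZ, hAZ, hZB⟩ := exists_clopen_of_closed_subset_open
    (hA.isCompact.image hq).isClosed (hB.isCompact.image hq).isClosed.isOpen_compl
    (show q '' A ⊆ (q '' B)ᶜ by
      rintro _ ⟨a, ha, rfl⟩ ⟨b, hb, hab⟩
      have hb' : b ∈ connectedComponent a := by
        rw [← ConnectedComponents.coe_eq_coe.1 hab]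
        exact mem_connectedComponent
      exact (h a ha).le_bot ⟨hb', hb⟩)
  exact ⟨q ⁻¹' Z, hZ.preimage hq, image_subset_iff.1 hAZ,
    Set.disjoint_left.2 fun x hx hxB => hZB hx (mem_image_of_mem q hxB)⟩

/-- **Browder's theorem**: the fixed points of a one-parameter family of maps with bounded range
contain a connected set joining the two ends of the parameter interval. -/
theorem exists_isConnected_fixedPoints {E : Type*} [NormedAddCommGroup E] [NormedSpace ℝ E]
    [FiniteDimensional ℝ E] {F : E × ℝ → E} (hF : Continuous F)
    (hb : Bornology.IsBounded (range F)) {a b : ℝ} (hab : a ≤ b) :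
    ∃ C : Set (E × ℝ), C ⊆ {p | p.2 ∈ Icc a b ∧ F p = p.1} ∧ IsConnected C ∧
      (∃ p ∈ C, p.2 = a) ∧ ∃ p ∈ C, p.2 = b := by
  let S : Set (E × ℝ) := {p | p.2 ∈ Icc a b ∧ F p = p.1}
  have hSclosed : IsClosed S :=
    (isClosed_Icc.preimage continuous_snd).inter (isClosed_eq hF continuous_fst)
  have hSbdd : Bornology.IsBounded S := by
    refine (hb.prod (isBounded_Icc a b)).subset fun p hp => ⟨?_, hp.1⟩
    rw [← hp.2]
    exact mem_range_self p
  have hScomp : IsCompact S := isCompact_of_isClosed_isBounded hSclosed hSbdd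
  have : CompactSpace S := isCompact_iff_compactSpace.1 hScomp
  have hcont : Continuous fun p : S => p.1.2 := continuous_snd.comp continuous_subtype_val
  let A : Set S := {p | p.1.2 = a}
  let B : Set S := {p | p.1.2 = b}
  by_contra! hno
  obtain ⟨Z, hZ, hAZ, hZB⟩ := exists_isClopen_of_disjoint_connectedComponent
    (isClosed_eq hcont continuous_const : IsClosed A)
    (isClosed_eq hcont continuous_const : IsClosed B) (fun p hp => by
      rw [Set.disjoint_left]
      intro p' hp' hB
      exact hno (Subtype.val '' connectedComponent p) (by rintro _ ⟨y, -, rfl⟩; exact y.2)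
        (isConnected_connectedComponent.image _ continuous_subtype_val.continuousOn)
        ⟨p, mem_image_of_mem _ mem_connectedComponent, hp⟩ p' (mem_image_of_mem _ hp') hB)
  obtain ⟨τ, hτ0, hτ1, hτ⟩ := exists_continuous_zero_one_of_isClosed
    (hSclosed.isClosedEmbedding_subtypeVal.isClosedMap _ hZ.compl.isClosed)
    (hSclosed.isClosedEmbedding_subtypeVal.isClosedMap _ hZ.isClosed)
    ((disjoint_image_iff Subtype.val_injective).2 disjoint_compl_left)
  obtain ⟨⟨x, u⟩, hxu⟩ := exists_eq_of_isBounded_range (E := E × ℝ)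
    (f := fun p => (F p, a + (b - a) * τ p)) (by fun_prop) (by
      refine (hb.prod (isBounded_Icc a b)).subset ?_
      rintro _ ⟨p, rfl⟩
      refine ⟨mem_range_self p, ?_⟩
      have := hτ p
      constructor <;> nlinarith [this.1, this.2])
  obtain ⟨hx, hu⟩ := Prod.mk.inj hxu
  have hS : (x, u) ∈ S := by
    refine ⟨?_, hx⟩
    have := hτ (x, u)
    rw [← hu]
    constructor <;> nlinarith [this.1, this.2]
  by_cases hz : (⟨(x, u), hS⟩ : S) ∈ Z
  · rw [hτ1 (mem_image_of_mem Subtype.val hz)] at hu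
    refine Set.disjoint_left.1 hZB hz (?_ : u = b)
    simp at hu
    exact hu.symm
  · rw [hτ0 (mem_image_of_mem Subtype.val (show (⟨(x, u), hS⟩ : S) ∈ Zᶜ from hz))] at hu
    refine hz (hAZ (?_ : u = a))
    simp at hu
    exact hu.symm

section
variable {n : ℕ}

/-- The running maximum of the nonnegative parts of the entries of `x` in the upper half of the
index range. -/
noncomputable def upperRunMax (x : Fin n → ℝ) (j : Fin n) : ℝ :=
  Finset.univ.sup' ⟨j, Finset.mem_univ j⟩
    fun i => if i ≤ j ∧ i.rev < i then max (x i) 0 else 0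

/-- A continuous retraction onto the monotone sequences that are odd under index reversal. -/
noncomputable def oddRunMax (x : Fin n → ℝ) (j : Fin n) : ℝ :=
  upperRunMax x j - upperRunMax x j.rev

theorem continuous_oddRunMax : Continuous (oddRunMax : (Fin n → ℝ) → Fin n → ℝ) := by
  have h (j : Fin n) : Continuous fun x : Fin n → ℝ => upperRunMax x j := by
    refine Continuous.finset_sup'_apply _ fun i _ => ?_
    split_ifs
    · fun_prop
    · fun_prop
  exact continuous_pi fun j => (h j).sub (h j.rev)

theorem upperRunMax_mono (x : Fin n → ℝ) : Monotone (upperRunMax x) := by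
  intro j l hjl
  refine Finset.sup'_mono_fun fun i _ => ?_
  split_ifs with h1 h2 h2
  · exact le_rfl
  · exact absurd ⟨h1.1.trans hjl, h1.2⟩ h2
  · exact le_max_right _ _
  · exact le_rfl

theorem upperRunMax_nonneg (x : Fin n → ℝ) (j : Fin n) : 0 ≤ upperRunMax x j := by
  refine le_trans ?_ (Finset.le_sup' _ (Finset.mem_univ j))
  split_ifs
  · exact le_max_right _ _
  · exact le_rfl

theorem upperRunMax_eq_zero (x : Fin n → ℝ) {j : Fin n} (hj : j ≤ j.rev) :
    upperRunMax x j = 0 := by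
  refine le_antisymm (Finset.sup'_le _ _ fun i _ => ?_) (upperRunMax_nonneg x j)
  rw [if_neg]
  rintro ⟨h1, h2⟩
  exact absurd (((Fin.rev_le_rev.2 h1).trans_lt h2).trans_le h1) hj.not_gt

theorem oddRunMax_of_rev_le (x : Fin n → ℝ) {j : Fin n} (hj : j.rev ≤ j) :
    oddRunMax x j = upperRunMax x j := by
  rw [oddRunMax, upperRunMax_eq_zero x (j := j.rev) (by rwa [Fin.rev_rev]), sub_zero]

theorem oddRunMax_mono (x : Fin n → ℝ) : Monotone (oddRunMax x) := fun _ _ h =>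
  sub_le_sub (upperRunMax_mono x h) (upperRunMax_mono x (Fin.rev_le_rev.2 h))

theorem oddRunMax_rev (x : Fin n → ℝ) (j : Fin n) : oddRunMax x j.rev = -oddRunMax x j := by
  simp [oddRunMax]

theorem oddRunMax_eq_self {x : Fin n → ℝ} (hodd : ∀ j, x j.rev = -x j)
    (htie : ∀ i j, i < j → oddRunMax x i = oddRunMax x j → x i < x j) : oddRunMax x = x := by
  have hup (j : Fin n) (hj : j.rev < j) : oddRunMax x j = x j := by
    rw [oddRunMax_of_rev_le x hj.le]
    refine le_antisymm ?_ ?_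
    · by_contra! hlt
      obtain ⟨i, -, hi⟩ := Finset.exists_mem_eq_sup' ⟨j, Finset.mem_univ j⟩
        fun i => if i ≤ j ∧ i.rev < i then max (x i) 0 else 0
      change upperRunMax x j = _ at hi
      have hzero : upperRunMax x j ≠ 0 := by
        intro h0
        have h1 : oddRunMax x j = 0 := by rw [oddRunMax_of_rev_le x hj.le, h0]
        have h2 := htie _ _ hj (by rw [oddRunMax_rev, h1, neg_zero])
        rw [hodd] at h2
        linarith
      split_ifs at hi with h
      · rcases max_choice (x i) 0 with hm | hm
        · rw [hm] at hi
          have hij : i < j := h.1.lt_of_ne (by rintro rfl; exact hlt.ne' hi)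
          have hle : x i ≤ upperRunMax x i := by
            refine le_trans ?_ (Finset.le_sup' _ (Finset.mem_univ i))
            rw [if_pos ⟨le_rfl, h.2⟩]
            exact le_max_left _ _
          have := htie i j hij (by
            rw [oddRunMax_of_rev_le x hj.le, oddRunMax_of_rev_le x h.2.le]
            exact le_antisymm (upperRunMax_mono x hij.le) (hi.trans_le hle))
          linarith
        · exact hzero (hi.trans hm)
      · exact hzero hi
    · refine le_trans ?_ (Finset.le_sup' _ (Finset.mem_univ j))
      rw [if_pos ⟨le_rfl, hj⟩]
      exact le_max_left _ _
  funext j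
  rcases lt_trichotomy j.rev j with hj | hj | hj
  · exact hup j hj
  · have h1 := hodd j
    have h2 := oddRunMax_rev x j
    rw [hj] at h1 h2
    linarith
  · have h1 := hup j.rev (by rwa [Fin.rev_rev])
    rw [oddRunMax_rev, hodd] at h1
    linarith

theorem strictMono_of_oddRunMax {x : Fin n → ℝ} (hodd : ∀ j, x j.rev = -x j)
    (htie : ∀ i j, i < j → oddRunMax x i = oddRunMax x j → x i < x j) : StrictMono x := by
  have h := oddRunMax_eq_self hodd htie
  intro i j hij
  rcases (oddRunMax_mono x hij.le).eq_or_lt with heq | hlt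
  · exact htie i j hij heq
  · rwa [h] at hlt
end

/-- The projection of the real line onto `[-c, c]`. -/
def clip (c x : ℝ) : ℝ := max (-c) (min c x)

theorem clip_neg {c : ℝ} (hc : 0 ≤ c) (x : ℝ) : clip c (-x) = -clip c x := by
  unfold clip
  rcases le_total c x with h1 | h1 <;> rcases le_total (-c) x with h2 | h2 <;>
    rcases le_total c (-x) with h3 | h3 <;> simp [h1, h2, h3] <;> grind

theorem clip_mem {c : ℝ} (hc : 0 ≤ c) (x : ℝ) : clip c x ∈ Icc (-c) c :=
  ⟨le_max_left _ _, max_le (by linarith) (min_le_left _ _)⟩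

theorem clip_nonneg {c x : ℝ} (hc : 0 ≤ c) (hx : 0 ≤ x) : 0 ≤ clip c x :=
  le_max_of_le_right (le_min hc hx)

theorem clip_eq_self {c x : ℝ} (hx : x ∈ Icc (-c) c) : clip c x = x := by
  rw [clip, min_eq_right hx.2, max_eq_right hx.1]

theorem continuous_clip (c : ℝ) : Continuous (clip c) := by
  unfold clip; fun_prop

theorem theta_neg (U x : ℝ) : theta U (-x) = -theta U x := by
  simp [theta, mul_neg, neg_div, arctan_neg]

theorem neg_pi_le_theta (U x : ℝ) : -π ≤ theta U x := by
  have := arctan_lt_pi_div_two (2 * x / U)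
  unfold theta; linarith

theorem theta_antitone {U : ℝ} (hU : 0 < U) : Antitone (theta U) := by
  intro x y hxy
  have : arctan (2 * x / U) ≤ arctan (2 * y / U) := by gcongr
  unfold theta; linarith

theorem continuousOn_theta {X : Type*} [TopologicalSpace X] {s : Set X} {U x : X → ℝ}
    (hU : ContinuousOn U s) (hx : ContinuousOn x s) (h0 : ∀ p ∈ s, U p ≠ 0) :
    ContinuousOn (fun p => theta (U p) (x p)) s :=
  continuousOn_const.mul (continuous_arctan.comp_continuousOn
    ((continuousOn_const.mul hx).div hU h0))

/-- At the edge of a large enough window the charges' contribution dominates the spin equation. -/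
theorem exists_theta_radius {N : ℕ} (hN : 0 < N) (U₁ : ℝ) (hU₁ : 0 < U₁) :
    ∃ R : ℝ, 0 ≤ R ∧ ∀ U s, 0 < U → U ≤ U₁ → s ≤ 1 →
      ((N : ℝ) - 1) * π < N * theta U (2 * s - 2 * R) := by
  have hN' : (0 : ℝ) < N := by exact_mod_cast hN
  have hlim : Tendsto (fun y => N * (2 * arctan y)) atTop (𝓝 (N * (2 * (π / 2)))) :=
    ((tendsto_nhds_of_tendsto_nhdsWithin tendsto_arctan_atTop).const_mul 2).const_mul _
  obtain ⟨y, hy, hy0⟩ := ((hlim.eventually_const_lt (u := ((N : ℝ) - 1) * π)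
    (by nlinarith [pi_pos])).and (eventually_ge_atTop 0)).exists
  refine ⟨1 + U₁ * y / 4, by positivity, fun U s hU hUU hs => hy.trans_le ?_⟩
  have : arctan y ≤ arctan (-(2 * (2 * s - 2 * (1 + U₁ * y / 4)) / U)) := by
    refine arctan_mono ?_
    rw [← neg_div, le_div_iff₀ hU]
    nlinarith
  rw [arctan_neg] at this
  refine mul_le_mul_of_nonneg_left ?_ hN'.le
  unfold theta
  linarith

theorem sum_theta_nonpos {M : ℕ} {U : ℝ} (hU : 0 < U) {L : Fin M → ℝ}
    (hL : ∀ β, L β.rev = -L β) {s : ℝ} (hs : 0 ≤ s) :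
    ∑ β, theta U (2 * s - 2 * L β) ≤ 0 := by
  have h1 : ∑ β, theta U (2 * s - 2 * L β) = ∑ β, theta U (2 * s + 2 * L β) := by
    rw [← Equiv.sum_comp Fin.revPerm]
    simp [hL]
  have h2 : ∑ β, (theta U (2 * s - 2 * L β) + theta U (2 * s + 2 * L β)) ≤ 0 := by
    refine Finset.sum_nonpos fun β _ => ?_
    have h3 := theta_antitone hU (show -(2 * s - 2 * L β) ≤ 2 * s + 2 * L β by linarith)
    rw [theta_neg] at h3
    linarith
  rw [Finset.sum_add_distrib] at h2
  linarith

/-- The centred quantum number attached to the index `j` of `Fin n`. -/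
noncomputable def quantum {n : ℕ} (j : Fin n) : ℝ := ((j : ℕ) : ℝ) + 1 - ((n : ℝ) + 1) / 2

theorem quantum_rev {n : ℕ} (j : Fin n) : quantum j.rev = -quantum j := by
  have : ((j.rev : ℕ) : ℝ) + (j + 1) = n := by
    have := j.2
    rw [Fin.val_rev]
    exact_mod_cast (by omega : n - (j + 1) + (j + 1) = n)
  unfold quantum; linarith

theorem quantum_lt {n : ℕ} {i j : Fin n} (h : i < j) : quantum i < quantum j := by
  have : ((i : ℕ) : ℝ) < ((j : ℕ) : ℝ) := by exact_mod_cast h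
  unfold quantum; linarith

theorem quantum_le {n : ℕ} (j : Fin n) : quantum j ≤ ((n : ℝ) - 1) / 2 := by
  have : ((j : ℕ) : ℝ) + 1 ≤ n := by exact_mod_cast j.2
  unfold quantum; linarith

section
variable {N M : ℕ}

/-- The right-hand side of the charge equation, solved for `k j`. -/
noncomputable def chargeMap (Na : ℕ) (U : ℝ) (k : Fin N → ℝ) (L : Fin M → ℝ) (j : Fin N) : ℝ :=
  (2 * π * quantum j + ∑ β, theta U (2 * sin (k j) - 2 * L β)) / Na

/-- The defect of the spin equation. -/
noncomputable def spinDefect (U : ℝ) (k : Fin N → ℝ) (L : Fin M → ℝ) (α : Fin M) : ℝ :=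
  2 * π * quantum α - ∑ β, theta U (L α - L β) - ∑ j, theta U (2 * sin (k j) - 2 * L α)

theorem chargeMap_rev (Na : ℕ) (U : ℝ) {k : Fin N → ℝ} {L : Fin M → ℝ}
    (hk : ∀ j, k j.rev = -k j) (hL : ∀ β, L β.rev = -L β) (j : Fin N) :
    chargeMap Na U k L j.rev = -chargeMap Na U k L j := by
  have h : ∑ β, theta U (2 * sin (k j.rev) - 2 * L β) =
      -∑ β, theta U (2 * sin (k j) - 2 * L β) := by
    rw [← Equiv.sum_comp Fin.revPerm, ← Finset.sum_neg_distrib]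
    refine Finset.sum_congr rfl fun β _ => ?_
    rw [← theta_neg, Fin.revPerm_apply, hk, hL, sin_neg]
    congr 1; ring
  rw [chargeMap, chargeMap, h, quantum_rev]
  ring

theorem spinDefect_rev (U : ℝ) {k : Fin N → ℝ} {L : Fin M → ℝ}
    (hk : ∀ j, k j.rev = -k j) (hL : ∀ β, L β.rev = -L β) (α : Fin M) :
    spinDefect U k L α.rev = -spinDefect U k L α := by
  have h1 : ∑ β, theta U (L α.rev - L β) = -∑ β, theta U (L α - L β) := by
    rw [← Equiv.sum_comp Fin.revPerm, ← Finset.sum_neg_distrib]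
    refine Finset.sum_congr rfl fun β _ => ?_
    rw [← theta_neg, Fin.revPerm_apply, hL, hL]
    congr 1; ring
  have h2 : ∑ j, theta U (2 * sin (k j) - 2 * L α.rev) =
      -∑ j, theta U (2 * sin (k j) - 2 * L α) := by
    rw [← Equiv.sum_comp Fin.revPerm, ← Finset.sum_neg_distrib]
    refine Finset.sum_congr rfl fun j _ => ?_
    rw [← theta_neg, Fin.revPerm_apply, hk, hL, sin_neg]
    congr 1; ring
  rw [spinDefect, spinDefect, h1, h2, quantum_rev]
  ring

theorem chargeMap_lt {Na : ℕ} (hNa : 0 < Na) (U : ℝ) {k : Fin N → ℝ} (L : Fin M → ℝ)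
    {i j : Fin N} (hij : i < j) (h : k i = k j) :
    chargeMap Na U k L i < chargeMap Na U k L j := by
  have hNa' : (0 : ℝ) < Na := by exact_mod_cast hNa
  have := quantum_lt hij
  unfold chargeMap
  rw [h]
  gcongr

theorem add_spinDefect_lt (U : ℝ) (k : Fin N → ℝ) {L : Fin M → ℝ}
    {α γ : Fin M} (hαγ : α < γ) (h : L α = L γ) :
    L α + spinDefect U k L α < L γ + spinDefect U k L γ := by
  have := quantum_lt hαγ
  unfold spinDefect
  rw [h]
  gcongr

theorem chargeMap_le_pi {Na : ℕ} (hN : 0 < N) (hNa : N ≤ Na) {U : ℝ} (hU : 0 < U)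
    {k : Fin N → ℝ} {L : Fin M → ℝ} (hL : ∀ β, L β.rev = -L β) {j : Fin N}
    (hk : k j ∈ Icc 0 π) : chargeMap Na U k L j ≤ π := by
  have hNa' : (N : ℝ) ≤ Na := by exact_mod_cast hNa
  have hN' : (0 : ℝ) < N := by exact_mod_cast hN
  have h1 := sum_theta_nonpos hU hL (sin_nonneg_of_mem_Icc hk)
  have h2 := quantum_le j
  rw [chargeMap, div_le_iff₀ (hN'.trans_le hNa')]
  nlinarith [pi_pos]

theorem spinDefect_neg (hMN : 2 * M ≤ N) {U R : ℝ}
    (hR : ∀ s ≤ 1, ((N : ℝ) - 1) * π < N * theta U (2 * s - 2 * R))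
    (k : Fin N → ℝ) {L : Fin M → ℝ} {α : Fin M} (hL : L α = R) : spinDefect U k L α < 0 := by
  have hM : 0 < M := α.pos
  have hN' : (0 : ℝ) < N := by exact_mod_cast (by omega : 0 < N)
  have hMN' : 2 * (M : ℝ) ≤ N := by exact_mod_cast hMN
  have h1 : -((M : ℝ) * π) ≤ ∑ β, theta U (L α - L β) := by
    have := Finset.card_nsmul_le_sum Finset.univ (fun β => theta U (L α - L β)) (-π)
      fun β _ => neg_pi_le_theta _ _
    simpa using this
  have h2 : ((N : ℝ) - 1) * π < ∑ j, theta U (2 * sin (k j) - 2 * L α) := by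
    have : ∑ _j : Fin N, ((N : ℝ) - 1) * π / N < ∑ j, theta U (2 * sin (k j) - 2 * L α) := by
      refine Finset.sum_lt_sum_of_nonempty ⟨⟨0, by omega⟩, Finset.mem_univ _⟩ fun j _ => ?_
      rw [div_lt_iff₀' hN', hL]
      exact hR _ (sin_le_one _)
    rwa [Finset.sum_const, Finset.card_univ, Fintype.card_fin, nsmul_eq_mul,
      mul_div_cancel₀ _ hN'.ne'] at this
  have h3 := quantum_le α
  unfold spinDefect
  nlinarith [pi_pos]

/-- Fixed points of the truncated Lieb–Wu map are ordered solutions on which the truncation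
acts trivially. -/
theorem truncation_trivial {Na : ℕ} (hN : 0 < N) (hMN : 2 * M ≤ N) (hNa : N ≤ Na) {U R : ℝ}
    (hU : 0 < U) (hR0 : 0 ≤ R) (hR : ∀ s ≤ 1, ((N : ℝ) - 1) * π < N * theta U (2 * s - 2 * R))
    {k k' : Fin N → ℝ} {L L' : Fin M → ℝ}
    (hk' : k' = fun j => clip π (oddRunMax k j)) (hL' : L' = fun α => clip R (oddRunMax L α))
    (hk : ∀ j, chargeMap Na U k' L' j = k j) (hL : ∀ α, L' α + spinDefect U k' L' α = L α) :
    StrictMono k ∧ StrictMono L ∧ (∀ j, k j ∈ Icc (-π) π) ∧ k' = k ∧ L' = L := by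
  have hk'odd (j) : k' j.rev = -k' j := by
    simp only [hk', oddRunMax_rev, clip_neg pi_pos.le]
  have hL'odd (α) : L' α.rev = -L' α := by
    simp only [hL', oddRunMax_rev, clip_neg hR0]
  have hkodd (j) : k j.rev = -k j := by
    rw [← hk, ← hk, chargeMap_rev Na U hk'odd hL'odd]
  have hLodd (α) : L α.rev = -L α := by
    rw [← hL, ← hL, spinDefect_rev U hk'odd hL'odd, hL'odd]
    ring
  have hktie (i j) (hij : i < j) (h : oddRunMax k i = oddRunMax k j) : k i < k j := by
    rw [← hk, ← hk]
    exact chargeMap_lt (hN.trans_le hNa) U L' hij (by simp only [hk', h])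
  have hLtie (i j) (hij : i < j) (h : oddRunMax L i = oddRunMax L j) : L i < L j := by
    rw [← hL, ← hL]
    exact add_spinDefect_lt U k' hij (by simp only [hL', h])
  have hkmono := strictMono_of_oddRunMax hkodd hktie
  have hLmono := strictMono_of_oddRunMax hLodd hLtie
  rw [oddRunMax_eq_self hkodd hktie] at hk'
  rw [oddRunMax_eq_self hLodd hLtie] at hL'
  have hkpi (j) : k j ≤ π := by
    rcases lt_or_ge j j.rev with hj | hj
    · have := hkmono hj
      rw [hkodd] at this
      linarith [pi_pos]
    · have h0 : 0 ≤ k j := by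
        have := hkmono.monotone hj
        rw [hkodd] at this
        linarith
      rw [← hk]
      refine chargeMap_le_pi hN hNa hU hL'odd ?_
      rw [hk']
      exact ⟨clip_nonneg pi_pos.le h0, (clip_mem pi_pos.le _).2⟩
  have hLR (α) : L α ≤ R := by
    by_contra! hlt
    have h1 : L' α = R := by
      rw [hL']
      simp only [clip]
      rw [min_eq_left hlt.le, max_eq_right (by linarith)]
    have h2 := spinDefect_neg hMN hR k' h1
    have h3 := hL α
    linarith
  have hkmem (j) : k j ∈ Icc (-π) π :=
    ⟨by have := hkpi j.rev; rw [hkodd] at this; linarith, hkpi j⟩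
  have hLmem (α) : L α ∈ Icc (-R) R :=
    ⟨by have := hLR α.rev; rw [hLodd] at this; linarith, hLR α⟩
  exact ⟨hkmono, hLmono, hkmem, hk'.trans (funext fun j => clip_eq_self (hkmem j)),
    hL'.trans (funext fun α => clip_eq_self (hLmem α))⟩

theorem continuousOn_liebWu (Na : ℕ) :
    ContinuousOn (fun p : (Fin N → ℝ) × (Fin M → ℝ) × ℝ =>
      ((fun j => chargeMap Na p.2.2 p.1 p.2.1 j, fun α => p.2.1 α + spinDefect p.2.2 p.1 p.2.1 α) :
        (Fin N → ℝ) × (Fin M → ℝ))) {p | 0 < p.2.2} := by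
  have hth {x : (Fin N → ℝ) × (Fin M → ℝ) × ℝ → ℝ} (hx : Continuous x) :
      ContinuousOn (fun p : (Fin N → ℝ) × (Fin M → ℝ) × ℝ => theta p.2.2 (x p)) {p | 0 < p.2.2} :=
    continuousOn_theta (by fun_prop) hx.continuousOn fun p hp => ne_of_gt hp
  refine ContinuousOn.prodMk (continuousOn_pi.2 fun j => ?_) (continuousOn_pi.2 fun α => ?_)
  · exact (continuousOn_const.add
      (continuousOn_finsetSum _ fun β _ => hth (by fun_prop))).div_const _
  · exact ContinuousOn.add (by fun_prop) ((continuousOn_const.sub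
      (continuousOn_finsetSum _ fun β _ => hth (by fun_prop))).sub
      (continuousOn_finsetSum _ fun j _ => hth (by fun_prop)))
end

/-- The set of ordered solutions `(k, Λ, U)` of the Lieb–Wu equations with coupling
`U ∈ [U₀, U₁]` contains a connected subset meeting both slices `{U = U₀}` and
`{U = U₁}`. -/
theorem liebWu_connected_family_of_solutions
    (N M Na : ℕ) (hNpos : 0 < N) (hNeven : N % 2 = 0) (hModd : M % 2 = 1)
    (hMN : 2 * M ≤ N) (hNa : N ≤ Na) (U₀ U₁ : ℝ) (hU₀ : 0 < U₀) (hU₀₁ : U₀ ≤ U₁) :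
    ∃ C : Set ((Fin N → ℝ) × (Fin M → ℝ) × ℝ),
      C ⊆ {p : (Fin N → ℝ) × (Fin M → ℝ) × ℝ |
        p.2.2 ∈ Set.Icc U₀ U₁ ∧
        StrictMono p.1 ∧ StrictMono p.2.1 ∧
        (∀ j : Fin N, p.1 j ∈ Set.Icc (-π) π) ∧
        (∀ j : Fin N, (Na : ℝ) * p.1 j =
            2 * π * (((j : ℕ) : ℝ) + 1 - ((N : ℝ) + 1) / 2)
              + ∑ β : Fin M, theta p.2.2 (2 * Real.sin (p.1 j) - 2 * p.2.1 β)) ∧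
        (∀ α : Fin M, ∑ j : Fin N, theta p.2.2 (2 * Real.sin (p.1 j) - 2 * p.2.1 α) =
            2 * π * (((α : ℕ) : ℝ) + 1 - ((M : ℝ) + 1) / 2)
              - ∑ β : Fin M, theta p.2.2 (p.2.1 α - p.2.1 β))} ∧
      IsConnected C ∧ (∃ p ∈ C, p.2.2 = U₀) ∧ (∃ p ∈ C, p.2.2 = U₁) := by
  obtain ⟨R, hR0, hR⟩ := exists_theta_radius hNpos U₁ (hU₀.trans_le hU₀₁)
  let trunc : ((Fin N → ℝ) × (Fin M → ℝ)) × ℝ → (Fin N → ℝ) × (Fin M → ℝ) × ℝ := fun p =>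
    (fun j => clip π (oddRunMax p.1.1 j), fun α => clip R (oddRunMax p.1.2 α),
      max U₀ (min U₁ p.2))
  let box : Set ((Fin N → ℝ) × (Fin M → ℝ) × ℝ) :=
    Icc (fun _ => -π) (fun _ => π) ×ˢ Icc (fun _ => -R) (fun _ => R) ×ˢ Icc U₀ U₁
  have hbox : IsCompact box := isCompact_Icc.prod (isCompact_Icc.prod isCompact_Icc)
  have htrunc_mem (p) : trunc p ∈ box :=
    ⟨⟨fun j => (clip_mem pi_pos.le _).1, fun j => (clip_mem pi_pos.le _).2⟩,
      ⟨fun j => (clip_mem hR0 _).1, fun j => (clip_mem hR0 _).2⟩,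
      le_max_left _ _, max_le hU₀₁ (min_le_left _ _)⟩
  have htrunc : Continuous trunc := by
    refine Continuous.prodMk (continuous_pi fun j => (continuous_clip π).comp
      ((continuous_apply j).comp (continuous_oddRunMax.comp (by fun_prop))))
      (Continuous.prodMk (continuous_pi fun j => (continuous_clip R).comp
      ((continuous_apply j).comp (continuous_oddRunMax.comp (by fun_prop)))) (by fun_prop))
  have hG := (continuousOn_liebWu (N := N) (M := M) Na).mono
    (fun p (hp : p ∈ box) => hU₀.trans_le hp.2.2.1)
  obtain ⟨C, hC, hconn, ⟨p₀, hp₀, h₀⟩, p₁, hp₁, h₁⟩ := exists_isConnected_fixedPoints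
    (hG.comp_continuous htrunc htrunc_mem)
    ((hbox.image_of_continuousOn hG).isBounded.subset
      (range_subset_iff.2 fun p => mem_image_of_mem _ (htrunc_mem p))) hU₀₁
  refine ⟨(fun p => (p.1.1, p.1.2, p.2)) '' C, ?_,
    hconn.image _ (by fun_prop), ⟨_, mem_image_of_mem _ hp₀, h₀⟩, _, mem_image_of_mem _ hp₁, h₁⟩
  rintro _ ⟨⟨⟨k, L⟩, U⟩, hp, rfl⟩
  obtain ⟨hU, hfix⟩ := hC hp
  have hUpos : 0 < U := hU₀.trans_le hU.1
  have hUmid : max U₀ (min U₁ U) = U := by rw [min_eq_right hU.2, max_eq_right hU.1]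
  obtain ⟨hk, hL⟩ := Prod.mk.inj hfix
  simp only [trunc, hUmid] at hk hL
  obtain ⟨hkmono, hLmono, hkmem, hk', hL'⟩ := truncation_trivial hNpos hMN hNa hUpos hR0
    (fun s hs => hR U s hUpos hU.2 hs) rfl rfl (congrFun hk) (congrFun hL)
  rw [hk', hL'] at hk hL
  refine ⟨hU, hkmono, hLmono, hkmem, fun j => ?_, fun α => ?_⟩
  · have hNa0 : (Na : ℝ) ≠ 0 := by exact_mod_cast (hNpos.trans_le hNa).ne'
    have := congrFun hk j
    rw [chargeMap, div_eq_iff hNa0] at this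
    rw [mul_comm, ← this, quantum]
  · have := congrFun hL α
    rw [spinDefect, quantum, congrFun hL' α] at this
    dsimp only
    linarith
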